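/- Let ℓ be an odd prime and let M be an invertible 2×2 matrix over 𝔽_ℓ with determinant q, whose characteristic polynomial has two distinct roots in 𝔽_ℓ. Let e be the least positive integer such that M^e is a scalar matrix (so e divides ℓ − 1). Then (ℓ − 1)/e is even if and only if q is a square in 𝔽_ℓ. -/

import Mathlib

open Matrix Polynomial

theorem aux_pow {R : Type*} [Field R] (M : Matrix (Fin 2) (Fin 2) R) (l1 l2 : R)
    (h : M * M = (l1 + l2) • M - (l1 * l2) • (1 : Matrix (Fin 2) (Fin 2) R)) (k : ℕ) :
    ∃ a b : R, M ^ k = a • M + b • (1 : Matrix (Fin 2) (Fin 2) R) ∧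
      l1 ^ k = a * l1 + b ∧ l2 ^ k = a * l2 + b := by
  induction k with
  | zero => exact ⟨0, 1, by simp, by simp, by simp⟩
  | succ k ih =>
    obtain ⟨a, b, h1, h2, h3⟩ := ih
    refine ⟨a * (l1 + l2) + b, - a * (l1 * l2), ?_, ?_, ?_⟩
    · rw [pow_succ, h1, add_mul, smul_mul_assoc, h, smul_mul_assoc, one_mul]
      module
    · rw [pow_succ, h2]; ring
    · rw [pow_succ, h3]; ring

/-- Let M be an invertible 2×2 matrix over 𝔽_ℓ with determinant q whose characteristic
polynomial has two distinct roots in 𝔽_ℓ, and let e be the least positive integer with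
M^e scalar. Then e divides ℓ − 1 and (ℓ − 1)/e is even iff q is a square in 𝔽_ℓ. -/
theorem stmt7 (ℓ : ℕ) [Fact (Nat.Prime ℓ)] (hodd : Odd ℓ)
    (M : Matrix (Fin 2) (Fin 2) (ZMod ℓ)) (hM : IsUnit M)
    (q : ZMod ℓ) (hq : M.det = q)
    (l1 l2 : ZMod ℓ) (hne : l1 ≠ l2)
    (hsplit : M.charpoly = (X - C l1) * (X - C l2))
    (e : ℕ)
    (he : IsLeast {k : ℕ | 0 < k ∧
      ∃ c : ZMod ℓ, M ^ k = c • (1 : Matrix (Fin 2) (Fin 2) (ZMod ℓ))} e) :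
    e ∣ ℓ - 1 ∧ (Even ((ℓ - 1) / e) ↔ IsSquare q) := by
  have hdet : l1 * l2 = M.det := by
    have := Matrix.det_eq_sign_charpoly_coeff M
    rw [hsplit] at this
    simp [coeff_zero_eq_eval_zero] at this
    exact this.symm
  have htr : l1 + l2 = M.trace := by
    have h1 := congrArg (eval 1) hsplit
    rw [Matrix.charpoly_fin_two] at h1
    simp at h1
    linear_combination h1 + hdet
  have hsq : M * M = (l1 + l2) • M - (l1 * l2) • (1 : Matrix (Fin 2) (Fin 2) (ZMod ℓ)) := by
    rw [hdet, htr]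
    ext i j
    fin_cases i <;> fin_cases j <;>
      simp [Matrix.mul_apply, Matrix.trace_fin_two, Matrix.det_fin_two] <;> ring
  have hns : ∀ c : ZMod ℓ, M ≠ c • (1 : Matrix (Fin 2) (Fin 2) (ZMod ℓ)) := by
    intro c hc
    rw [hc] at hdet htr
    simp [Matrix.trace_fin_two, Matrix.det_fin_two] at hdet htr
    apply hne
    have : (l1 - l2) ^ 2 = 0 := by
      linear_combination (l1 + l2 + 2 * c) * htr - 4 * hdet
    exact sub_eq_zero.mp (pow_eq_zero_iff (two_ne_zero) |>.mp this)
  have key : ∀ k : ℕ, (∃ c : ZMod ℓ, M ^ k = c • (1 : Matrix (Fin 2) (Fin 2) (ZMod ℓ))) ↔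
      l1 ^ k = l2 ^ k := by
    intro k
    obtain ⟨a, b, h1, h2, h3⟩ := aux_pow M l1 l2 hsq k
    constructor
    · rintro ⟨c, hc⟩
      have ha : a = 0 := by
        by_contra ha
        apply hns (a⁻¹ * (c - b))
        have h4 : a • M = (c - b) • (1 : Matrix (Fin 2) (Fin 2) (ZMod ℓ)) := by
          rw [sub_smul, ← hc, h1]; abel
        rw [mul_smul, ← h4, smul_smul, inv_mul_cancel₀ ha, one_smul]
      rw [h2, h3, ha]; ring
    · intro h
      have ha : a = 0 := by
        have : a * (l1 - l2) = 0 := by linear_combination h - h2 + h3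
        exact (mul_eq_zero.mp this).resolve_right (sub_ne_zero.mpr hne)
      exact ⟨b, by rw [h1, ha]; simp⟩
  have hu : M.det ≠ 0 := ((Matrix.isUnit_iff_isUnit_det M).mp hM).ne_zero
  have hl1 : l1 ≠ 0 := by rintro rfl; simp at hdet; exact hu hdet.symm
  have hl2 : l2 ≠ 0 := by rintro rfl; simp at hdet; exact hu hdet.symm
  have key2 : ∀ k : ℕ, (∃ c : ZMod ℓ, M ^ k = c • (1 : Matrix (Fin 2) (Fin 2) (ZMod ℓ))) ↔
      (l1 / l2) ^ k = 1 := by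
    intro k
    rw [key, div_pow, div_eq_one_iff_eq (pow_ne_zero _ hl2)]
  have hu0 : l1 / l2 ≠ 0 := div_ne_zero hl1 hl2
  obtain ⟨⟨hepos, hec⟩, hmin⟩ := he
  have heo : orderOf (l1 / l2) = e := by
    have h1 := (key2 e).mp hec
    apply le_antisymm (orderOf_le_of_pow_eq_one hepos h1)
    apply hmin
    exact ⟨orderOf_pos_iff.mpr (isOfFinOrder_iff_pow_eq_one.mpr ⟨e, hepos, h1⟩),
      (key2 _).mpr (pow_orderOf_eq_one _)⟩
  have hd : e ∣ ℓ - 1 := by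
    rw [← heo]
    exact orderOf_dvd_of_pow_eq_one (ZMod.pow_card_sub_one_eq_one hu0)
  refine ⟨hd, ?_⟩
  have hqs : IsSquare q ↔ IsSquare (l1 / l2) := by
    rw [← hq, ← hdet]
    constructor
    · rintro ⟨r, hr⟩
      exact ⟨r / l2, by field_simp; linear_combination hr⟩
    · rintro ⟨r, hr⟩
      refine ⟨r * l2, ?_⟩
      rw [div_eq_iff hl2] at hr
      rw [hr]; ring
  rw [hqs, ZMod.euler_criterion ℓ hu0, ← orderOf_dvd_iff_pow_eq_one, heo]
  obtain ⟨m, rfl⟩ := hodd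
  obtain ⟨t, ht⟩ := hd
  have e1 : (2 * m + 1) / 2 = m := by omega
  have e2 : (2 * m + 1 - 1) / e = t := by rw [ht]; exact Nat.mul_div_cancel_left _ hepos
  have e3 : 2 * m = e * t := by omega
  rw [e1, e2]
  constructor
  · rintro ⟨s, rfl⟩
    exact ⟨s, by nlinarith⟩
  · rintro ⟨s, rfl⟩
    refine ⟨s, ?_⟩
    apply Nat.eq_of_mul_eq_mul_left hepos
    nlinarith
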